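/- Liouville-type theorem: Let f be a quaternionic entire function (a slice regular function on all of ℍ) of order at most 1 and type 0; that is, for every ε > 0 one has |f(q)| < e^{ε|q|} for all q with |q| sufficiently large. If for some I ∈ 𝕊 the plane L_I contains a real affine line on which |f| is bounded, then f is constant on ℍ. -/

import Mathlib

open scoped Quaternion

/-- The sphere of imaginary units in the quaternions. -/
def qSphere : Set ℍ[ℝ] := {q : ℍ[ℝ] | q.re = 0 ∧ ‖q‖ = 1}

/-- The point of the slice `L_I = ℝ + ℝI` corresponding to `z = x + iy ∈ ℂ`. -/
noncomputable def toSlice (I : ℍ[ℝ]) (z : ℂ) : ℍ[ℝ] := (z.re : ℍ[ℝ]) + z.im • I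

/-- `f` is slice regular on `Ω`: for each imaginary unit `I`, the restriction of `f` to
`Ω ∩ L_I`, read through the parametrization `toSlice I : ℂ → L_I`, is real differentiable
and satisfies the Cauchy–Riemann equation `∂f/∂x + I ∂f/∂y = 0`. -/
def SliceRegularOn (f : ℍ[ℝ] → ℍ[ℝ]) (Ω : Set ℍ[ℝ]) : Prop :=
  ∀ I ∈ qSphere, ∀ z : ℂ, toSlice I z ∈ Ω →
    ∃ D : ℂ →L[ℝ] ℍ[ℝ],
      HasFDerivWithinAt (fun w => f (toSlice I w)) D (toSlice I ⁻¹' Ω) z ∧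
      D 1 + I * D Complex.I = 0

/-- A slice domain: a domain meeting the real axis all of whose slices are domains. -/
def IsSliceDomain (Ω : Set ℍ[ℝ]) : Prop :=
  IsOpen Ω ∧ IsConnected Ω ∧ (∃ x : ℝ, (x : ℍ[ℝ]) ∈ Ω) ∧
  ∀ I ∈ qSphere, IsConnected (toSlice I ⁻¹' Ω)

/-- `cos θ + I sin θ`. -/
noncomputable def expI (I : ℍ[ℝ]) (θ : ℝ) : ℍ[ℝ] := (Real.cos θ : ℍ[ℝ]) + Real.sin θ • I

/-- The circular cone of opening `φ` around the positive real axis. -/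
def circularCone (φ : ℝ) : Set ℍ[ℝ] :=
  {q : ℍ[ℝ] | ∃ r θ : ℝ, ∃ I ∈ qSphere, 0 < r ∧ |θ| < φ / 2 ∧ q = r • expI I θ}

/-- `M_f(r)`: the maximum of `‖f‖` on the closure of `Ω` intersected with the sphere of radius `r`. -/
noncomputable def maxMod (f : ℍ[ℝ] → ℍ[ℝ]) (Ω : Set ℍ[ℝ]) (r : ℝ) : ℝ :=
  sSup ((fun q => ‖f q‖) '' (closure Ω ∩ Metric.sphere (0 : ℍ[ℝ]) r))

/-- The order of a slice regular function. -/
noncomputable def growthOrder (f : ℍ[ℝ] → ℍ[ℝ]) (Ω : Set ℍ[ℝ]) : EReal :=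
  Filter.limsup (fun r : ℝ =>
    ((max 0 (Real.log (max 0 (Real.log (maxMod f Ω r)))) / Real.log r : ℝ) : EReal))
    Filter.atTop

/-- The type of a slice regular function of order `ρ`. -/
noncomputable def growthType (f : ℍ[ℝ] → ℍ[ℝ]) (Ω : Set ℍ[ℝ]) (ρ : ℝ) : EReal :=
  Filter.limsup (fun r : ℝ => ((max 0 (Real.log (maxMod f Ω r)) / r ^ ρ : ℝ) : EReal))
    Filter.atTop

/-- The angle of opening `φ` bisected by the half line of argument `ζ` in the slice `L_I`. -/
def angleSet (I : ℍ[ℝ]) (ζ φ : ℝ) : Set ℍ[ℝ] :=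
  {q : ℍ[ℝ] | ∃ r θ : ℝ, 0 < r ∧ |θ| < φ / 2 ∧ q = r • expI I (ζ + θ)}

/-- The real affine line through `p` with direction `d`. -/
def lineSet (p d : ℍ[ℝ]) : Set ℍ[ℝ] := {q : ℍ[ℝ] | ∃ t : ℝ, q = p + t • d}

/-- `f` is slice preserving: it maps each slice into itself. -/
def SlicePreservingOn (f : ℍ[ℝ] → ℍ[ℝ]) (Ω : Set ℍ[ℝ]) : Prop :=
  ∀ I ∈ qSphere, ∀ q ∈ Ω ∩ Set.range (toSlice I), f q ∈ Set.range (toSlice I)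

/-- The principal quaternionic logarithm. -/
noncomputable def QLog (q : ℍ[ℝ]) : ℍ[ℝ] :=
  (Real.log ‖q‖ : ℍ[ℝ]) + Real.arccos (q.re / ‖q‖) • (‖q.im‖⁻¹ • q.im)

open Filter Topology Bornology Asymptotics

section MinimalExponentialType

variable {E : Type*} [NormedAddCommGroup E] [NormedSpace ℂ E]

/-- Phragmen-Lindelöf principle in the right half-plane for functions of minimal exponential
type. -/
lemma norm_le_right_half_plane_of_minimal_exponential_type {h : ℂ → E} {C : ℝ}
    (hd : Differentiable ℂ h)
    (hg : ∀ ε : ℝ, 0 < ε → h =O[cobounded ℂ] fun z => Real.exp (ε * ‖z‖))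
    (him : ∀ x : ℝ, ‖h (x * Complex.I)‖ ≤ C) {z : ℂ} (hz : 0 ≤ z.re) : ‖h z‖ ≤ C := by
  suffices ∀ᶠ ε : ℝ in 𝓝[>] 0, ‖Complex.exp (-ε * z) • h z‖ ≤ C by
    refine le_of_tendsto (Tendsto.mono_left ?_ nhdsWithin_le_nhds) this
    exact Continuous.tendsto' (by fun_prop) _ _ (by simp)
  filter_upwards [self_mem_nhdsWithin] with ε (hε : 0 < ε)
  refine PhragmenLindelof.right_half_plane_of_tendsto_zero_on_real
    (f := fun w => Complex.exp (-ε * w) • h w) ?_ ⟨1, by norm_num, ε + 1, ?_⟩ ?_ ?_ hz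
  · exact Differentiable.diffContOnCl (by fun_prop)
  · have hexp : (fun w : ℂ => Complex.exp (-ε * w)) =O[cobounded ℂ]
        fun w => Real.exp (ε * ‖w‖) := by
      refine IsBigO.of_bound 1 (Eventually.of_forall fun w => ?_)
      rw [Complex.norm_exp, Real.norm_eq_abs, Real.abs_exp, one_mul, Real.exp_le_exp]
      have := mul_le_mul_of_nonneg_left (neg_le_of_abs_le (Complex.abs_re_le_norm w)) hε.le
      simp only [Complex.mul_re, Complex.neg_re, Complex.ofReal_re, Complex.neg_im,
        Complex.ofReal_im]
      linarith
    refine ((hexp.smul (hg 1 one_pos)).mono inf_le_left).congr_right fun w => ?_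
    rw [smul_eq_mul, ← Real.exp_add, Real.rpow_one]
    ring_nf
  · have hreal : Tendsto (fun x : ℝ => (x : ℂ)) atTop (cobounded ℂ) := by
      rw [← tendsto_norm_atTop_iff_cobounded]
      simpa using tendsto_abs_atTop_atTop
    have hh := (hg (ε / 2) (half_pos hε)).comp_tendsto hreal
    have hexp : (fun x : ℝ => Complex.exp (-ε * x)) =O[atTop] fun x => Real.exp (-ε * x) :=
      IsBigO.of_bound 1 (Eventually.of_forall fun x => by simp [Complex.norm_exp])
    refine (hexp.smul hh).trans_tendsto ?_
    have hlim : Tendsto (fun x : ℝ => Real.exp (-(ε / 2 * x))) atTop (𝓝 0) :=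
      Real.tendsto_exp_neg_atTop_nhds_zero.comp (tendsto_id.const_mul_atTop (half_pos hε))
    refine hlim.congr' ?_
    filter_upwards [eventually_ge_atTop 0] with x hx
    simp only [Function.comp_apply, smul_eq_mul, ← Real.exp_add, Complex.norm_real,
      Real.norm_of_nonneg hx]
    ring_nf
  · intro x
    rw [norm_smul, Complex.norm_exp]
    simpa using him x

/-- An entire function of minimal exponential type that is bounded on a real affine line is
constant. -/
lemma apply_eq_apply_of_bounded_on_line {g : ℂ → E} {C : ℝ} (hd : Differentiable ℂ g)
    (hg : ∀ ε : ℝ, 0 < ε → g =O[cobounded ℂ] fun z => Real.exp (ε * ‖z‖))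
    (a b : ℂ) (hb : b ≠ 0) (hline : ∀ t : ℝ, ‖g (a + t * b)‖ ≤ C) (z w : ℂ) : g z = g w := by
  have half (c : ℂ) (hc : c ≠ 0) (him : ∀ t : ℝ, ‖g (a + t * Complex.I * c)‖ ≤ C) (z : ℂ)
      (hz : 0 ≤ z.re) : ‖g (a + z * c)‖ ≤ C := by
    refine norm_le_right_half_plane_of_minimal_exponential_type
      (h := fun z => g (a + z * c)) (by fun_prop) (fun ε hε => ?_) him hz
    have hlim : Tendsto (fun z : ℂ => a + z * c) (cobounded ℂ) (cobounded ℂ) :=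
      (tendsto_const_add_cobounded a).comp (tendsto_mul_right_cobounded hc)
    have hc' : 0 < ‖c‖ := norm_pos_iff.2 hc
    refine ((hg (ε / ‖c‖) (by positivity)).comp_tendsto hlim).trans
      (IsBigO.of_bound (Real.exp (ε / ‖c‖ * ‖a‖)) (Eventually.of_forall fun z => ?_))
    simp only [Function.comp_apply, Real.norm_eq_abs, Real.abs_exp, ← Real.exp_add,
      Real.exp_le_exp]
    calc ε / ‖c‖ * ‖a + z * c‖ ≤ ε / ‖c‖ * (‖a‖ + ‖z‖ * ‖c‖) := by
          gcongr
          exact (norm_add_le _ _).trans_eq (by rw [norm_mul])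
      _ = ε / ‖c‖ * ‖a‖ + ε * ‖z‖ := by field_simp
  have hbound (z : ℂ) : ‖g z‖ ≤ C := by
    have hI := Complex.I_ne_zero
    have hIb : Complex.I * b ≠ 0 := mul_ne_zero hI hb
    set u : ℂ := (z - a) / (Complex.I * b) with hu
    have hz : a + u * (Complex.I * b) = z := by
      rw [hu, div_mul_cancel₀ _ hIb]; ring
    rcases le_total 0 u.re with h | h
    · rw [← hz]
      refine half _ hIb (fun t => ?_) u h
      convert hline (-t) using 3
      push_cast
      linear_combination (t * b : ℂ) * Complex.I_sq
    · have hz' : a + -u * (-(Complex.I * b)) = z := by rw [neg_mul_neg, hz]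
      rw [← hz']
      refine half _ (neg_ne_zero.2 hIb) (fun t => ?_) (-u) (by simpa using h)
      convert hline t using 3
      linear_combination (-t * b : ℂ) * Complex.I_sq
  refine hd.apply_eq_apply_of_bounded (isBounded_iff_forall_norm_le.2 ⟨C, ?_⟩) z w
  rintro _ ⟨x, rfl⟩
  exact hbound x

end MinimalExponentialType

section Slice

lemma qSphere_mul_self {I : ℍ[ℝ]} (hI : I ∈ qSphere) : I * I = -1 := by
  have h : I * star I = 1 := by
    rw [Quaternion.self_mul_star, Quaternion.normSq_eq_norm_mul_self, hI.2]; simp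
  rw [Quaternion.star_eq_neg.2 hI.1, mul_neg] at h
  exact neg_eq_iff_eq_neg.1 h

/-- The parametrization of the slice `L_I` as a homomorphism of real algebras. -/
noncomputable def toSliceHom {I : ℍ[ℝ]} (hI : I ∈ qSphere) : ℂ →ₐ[ℝ] ℍ[ℝ] :=
  Complex.liftAux I (qSphere_mul_self hI)

lemma toSliceHom_apply {I : ℍ[ℝ]} (hI : I ∈ qSphere) (z : ℂ) : toSliceHom hI z = toSlice I z :=
  rfl

lemma norm_toSlice {I : ℍ[ℝ]} (hI : I ∈ qSphere) (z : ℂ) : ‖toSlice I z‖ = ‖z‖ := by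
  have hI2 := Quaternion.normSq_eq_norm_mul_self I
  rw [hI.2, Quaternion.normSq_def', hI.1] at hI2
  rw [← sq_eq_sq₀ (norm_nonneg _) (norm_nonneg _), sq, ← Quaternion.normSq_eq_norm_mul_self,
    Complex.sq_norm, Complex.normSq_apply, Quaternion.normSq_def']
  simp only [toSlice, Quaternion.re_add, Quaternion.imI_add, Quaternion.imJ_add,
    Quaternion.imK_add, Quaternion.re_coe, Quaternion.imI_coe, Quaternion.imJ_coe,
    Quaternion.imK_coe, Quaternion.re_smul, Quaternion.imI_smul, Quaternion.imJ_smul,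
    Quaternion.imK_smul, hI.1, smul_eq_mul]
  linear_combination z.im ^ 2 * hI2

lemma exists_toSlice_eq {I : ℍ[ℝ]} (hI : I ∈ qSphere) (q : ℍ[ℝ]) :
    ∃ J ∈ qSphere, ∃ z : ℂ, toSlice J z = q := by
  by_cases h : q.im = 0
  · exact ⟨I, hI, q.re, by simpa [toSlice, h] using q.re_add_im⟩
  · have h' : ‖q.im‖ ≠ 0 := norm_ne_zero_iff.2 h
    refine ⟨‖q.im‖⁻¹ • q.im, ⟨by simp, by rw [norm_smul]; simp [h']⟩, ⟨q.re, ‖q.im‖⟩, ?_⟩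
    simp [toSlice, smul_smul, h']

/-- The complex structure on the quaternions given by left multiplication by `I`. -/
noncomputable abbrev sliceNormedSpace {I : ℍ[ℝ]} (hI : I ∈ qSphere) : NormedSpace ℂ ℍ[ℝ] :=
  { (toSliceHom hI).toRingHom.toModule with
    norm_smul_le := fun z q => by
      change ‖toSlice I z * q‖ ≤ _
      rw [norm_mul, norm_toSlice hI] }

lemma apply_toSlice_eq_of_bounded_on_line {f : ℍ[ℝ] → ℍ[ℝ]} (hf : SliceRegularOn f Set.univ)
    (hgrowth : ∀ ε : ℝ, 0 < ε → ∃ R : ℝ, ∀ q : ℍ[ℝ], R ≤ ‖q‖ → ‖f q‖ < Real.exp (ε * ‖q‖))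
    {I : ℍ[ℝ]} (hI : I ∈ qSphere) {a b : ℂ} (hb : b ≠ 0) {C : ℝ}
    (hline : ∀ t : ℝ, ‖f (toSlice I (a + t * b))‖ ≤ C) (z w : ℂ) :
    f (toSlice I z) = f (toSlice I w) := by
  let := sliceNormedSpace hI
  have smul_def (z : ℂ) (q : ℍ[ℝ]) : z • q = toSlice I z * q := rfl
  have : IsScalarTower ℝ ℂ ℍ[ℝ] := ⟨fun r z q => by
    rw [smul_def, smul_def, ← toSliceHom_apply hI, map_smul, smul_mul_assoc]; rfl⟩
  refine apply_eq_apply_of_bounded_on_line (g := fun z => f (toSlice I z)) (fun z => ?_)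
    (fun ε hε => ?_) a b hb hline z w
  · obtain ⟨D, hD, hCR⟩ := hf I hI z (Set.mem_univ _)
    rw [Set.preimage_univ, hasFDerivWithinAt_univ] at hD
    refine (hasFDerivAt_of_restrictScalars ℝ
      (f' := (ContinuousLinearMap.toSpanSingleton ℂ (D 1))) hD ?_).differentiableAt
    have hDI : D Complex.I = I * D 1 := by
      rw [eq_neg_of_add_eq_zero_left hCR, mul_neg, ← mul_assoc, qSphere_mul_self hI]; simp
    ext1 w
    have hw : w = w.re • (1 : ℂ) + w.im • Complex.I := by simp
    have hDw : D w = w.re • D 1 + w.im • D Complex.I := by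
      conv_lhs => rw [hw, map_add, map_smul, map_smul]
    change w • D 1 = D w
    rw [hDw, hDI, smul_def, toSlice, add_mul, Quaternion.coe_mul_eq_smul, smul_mul_assoc]
  · obtain ⟨R, hR⟩ := hgrowth ε hε
    refine IsBigO.of_bound 1 ?_
    filter_upwards [tendsto_norm_cobounded_atTop.eventually_ge_atTop R] with z hz
    rw [← norm_toSlice hI] at hz
    simpa [norm_toSlice hI] using (hR _ hz).le

end Slice

/-- Liouville-type theorem for quaternionic entire functions of minimal exponential type. -/
theorem liouville_type
    (f : ℍ[ℝ] → ℍ[ℝ]) (hf : SliceRegularOn f Set.univ)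
    (hgrowth : ∀ ε : ℝ, 0 < ε → ∃ R : ℝ, ∀ q : ℍ[ℝ], R ≤ ‖q‖ → ‖f q‖ < Real.exp (ε * ‖q‖))
    (I : ℍ[ℝ]) (hI : I ∈ qSphere)
    (p d : ℍ[ℝ]) (hp : p ∈ Set.range (toSlice I)) (hd : d ∈ Set.range (toSlice I))
    (hd0 : d ≠ 0)
    (C : ℝ) (hbd : ∀ t : ℝ, ‖f (p + t • d)‖ ≤ C) :
    ∃ c : ℍ[ℝ], ∀ q : ℍ[ℝ], f q = c := by
  have hslice (J : ℍ[ℝ]) (x : ℝ) : toSlice J x = x := by simp [toSlice]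
  obtain ⟨a, rfl⟩ := hp
  obtain ⟨b, rfl⟩ := hd
  have hb : b ≠ 0 := by
    rintro rfl
    exact hd0 (by simp [toSlice])
  have hconst := apply_toSlice_eq_of_bounded_on_line hf hgrowth hI (a := a) hb (C := C)
    fun t => by
      rw [← Complex.real_smul, ← toSliceHom_apply hI, map_add, map_smul]
      exact hbd t
  refine ⟨f 0, fun q => ?_⟩
  have hreal (x : ℝ) : f x = f 0 := by
    simpa only [hslice, Quaternion.coe_zero] using hconst x (0 : ℝ)
  obtain ⟨J, hJ, z, rfl⟩ := exists_toSlice_eq hI q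
  have hJconst := apply_toSlice_eq_of_bounded_on_line hf hgrowth hJ (a := 0) one_ne_zero
    (C := ‖f 0‖) (fun t => by rw [zero_add, mul_one, hslice, hreal]) z (0 : ℝ)
  rwa [hslice, hreal] at hJconst
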